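/- Suppose H^0 is not trivial. Let ρ and σ be coactions of H^0 on unital C*-algebras A and B, respectively. If ρ is strongly Morita equivalent to σ, then ρ is outer if and only if σ is outer. -/

import Mathlib

open scoped TensorProduct
open Filter Topology
set_option maxHeartbeats 1000000
set_option linter.unusedSectionVars false
set_option synthInstance.maxHeartbeats 400000
noncomputable section
namespace SMEPaper
universe u

/-! ### Generalities on tensor products with a finite dimensional C*-algebra -/

/-- Contraction of the right tensor factor against a linear functional:
`appRight f (m ⊗ c) = f c • m`. -/
def appRight {M C : Type*} [AddCommGroup M] [Module ℂ M] [AddCommGroup C] [Module ℂ C]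
    (f : C →ₗ[ℂ] ℂ) : M ⊗[ℂ] C →ₗ[ℂ] M :=
  (TensorProduct.rid ℂ M).toLinearMap ∘ₗ TensorProduct.map LinearMap.id f

/-- The `i`-th coordinate, with respect to the canonical finite basis of `C`, of an
element of `M ⊗[ℂ] C`. -/
def tcoord {M C : Type*} [AddCommGroup M] [Module ℂ M] [AddCommGroup C] [Module ℂ C]
    [FiniteDimensional ℂ C] (i : Fin (Module.finrank ℂ C)) : M ⊗[ℂ] C →ₗ[ℂ] M :=
  appRight ((Module.finBasis ℂ C).coord i)

/-- The star operation on `M ⊗[ℂ] C` (`C` finite dimensional) where the star operation on the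
first factor is supplied as a function: on simple tensors, `m ⊗ c ↦ sM m ⊗ star c`. -/
def tstarWith {M C : Type*} [AddCommGroup M] [Module ℂ M] [Ring C] [Algebra ℂ C]
    [StarRing C] [FiniteDimensional ℂ C] (sM : M → M) (t : M ⊗[ℂ] C) : M ⊗[ℂ] C :=
  ∑ i, sM (tcoord i t) ⊗ₜ star (Module.finBasis ℂ C i)

/-- Combination of an operation on the first factors and an operation on the second (finite
dimensional) factors to an operation on tensor products: on simple tensors,
`tmix op cop (p ⊗ c) (q ⊗ d) = op p q ⊗ cop c d`. -/
def tmix {P Q R C : Type*} [AddCommGroup P] [Module ℂ P] [AddCommGroup Q] [Module ℂ Q]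
    [AddCommGroup R] [Module ℂ R] [Ring C] [Algebra ℂ C] [FiniteDimensional ℂ C]
    (op : P → Q → R) (cop : C → C → C) (s : P ⊗[ℂ] C) (t : Q ⊗[ℂ] C) : R ⊗[ℂ] C :=
  ∑ i, ∑ j,
    op (tcoord i s) (tcoord j t) ⊗ₜ cop (Module.finBasis ℂ C i) (Module.finBasis ℂ C j)

/-- The operation on tensor products induced by an operation on the first factors (and
multiplication in the second): `tact op (p ⊗ c) (q ⊗ d) = op p q ⊗ (c * d)`. -/
def tact {P Q R C : Type*} [AddCommGroup P] [Module ℂ P] [AddCommGroup Q] [Module ℂ Q]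
    [AddCommGroup R] [Module ℂ R] [Ring C] [Algebra ℂ C] [FiniteDimensional ℂ C]
    (op : P → Q → R) : P ⊗[ℂ] C → Q ⊗[ℂ] C → R ⊗[ℂ] C :=
  tmix op (· * ·)

/-- The left inner product on `X ⊗ C` induced by a left (`A`-valued) inner product on `X`:
`(x ⊗ c), (y ⊗ d) ↦ inn x y ⊗ (c * star d)`. -/
def tinnL {X A C : Type*} [AddCommGroup X] [Module ℂ X] [AddCommGroup A] [Module ℂ A]
    [Ring C] [Algebra ℂ C] [StarRing C] [FiniteDimensional ℂ C]
    (inn : X → X → A) : X ⊗[ℂ] C → X ⊗[ℂ] C → A ⊗[ℂ] C :=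
  tmix inn (fun c d => c * star d)

/-- The right inner product on `X ⊗ C` induced by a right (`B`-valued) inner product on `X`:
`(x ⊗ c), (y ⊗ d) ↦ inn x y ⊗ (star c * d)`. -/
def tinnR {X B C : Type*} [AddCommGroup X] [Module ℂ X] [AddCommGroup B] [Module ℂ B]
    [Ring C] [Algebra ℂ C] [StarRing C] [FiniteDimensional ℂ C]
    (inn : X → X → B) : X ⊗[ℂ] C → X ⊗[ℂ] C → B ⊗[ℂ] C :=
  tmix inn (fun c d => star c * d)

/-! ### Finite dimensional C*-Hopf algebras -/

/-- The data and axioms of a finite dimensional C*-Hopf algebra structure on the finite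
dimensional C*-algebra `H0`: a comultiplication, counit and antipode satisfying the Hopf
algebra axioms, compatibly with the ⋆-structure. -/
structure HopfAlgData (H0 : Type u) [Ring H0] [Algebra ℂ H0] [StarRing H0]
    [StarModule ℂ H0] [FiniteDimensional ℂ H0] where
  comul : H0 →ₐ[ℂ] H0 ⊗[ℂ] H0
  counit : H0 →ₐ[ℂ] ℂ
  antipode : H0 →ₗ[ℂ] H0
  coassoc : ∀ h, TensorProduct.map comul.toLinearMap LinearMap.id (comul h)
      = (TensorProduct.assoc ℂ H0 H0 H0).symm
          (TensorProduct.map LinearMap.id comul.toLinearMap (comul h))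
  counit_left : ∀ h,
      (TensorProduct.lid ℂ H0) (TensorProduct.map counit.toLinearMap LinearMap.id (comul h)) = h
  counit_right : ∀ h, appRight counit.toLinearMap (comul h) = h
  antipode_left : ∀ (h : H0) (n : ℕ) (h1 h2 : Fin n → H0),
      comul h = ∑ i, h1 i ⊗ₜ h2 i → ∑ i, antipode (h1 i) * h2 i = counit h • 1
  antipode_right : ∀ (h : H0) (n : ℕ) (h1 h2 : Fin n → H0),
      comul h = ∑ i, h1 i ⊗ₜ h2 i → ∑ i, h1 i * antipode (h2 i) = counit h • 1
  comul_star : ∀ h, comul (star h) = tstarWith star (comul h)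
  counit_star : ∀ h, counit (star h) = starRingEnd ℂ (counit h)

/-! ### Coactions on C*-algebras -/

section Coaction
variable {H0 : Type u} [Ring H0] [Algebra ℂ H0] [StarRing H0] [StarModule ℂ H0]
  [FiniteDimensional ℂ H0]
variable {A B X : Type u} [Ring A] [Algebra ℂ A] [StarRing A]
  [Ring B] [Algebra ℂ B] [StarRing B] [AddCommGroup X] [Module ℂ X]

/-- `ρ : A → A ⊗ H0` is a weak coaction of `H0` (with counit `ε0`) on `A`:
a unital ⋆-homomorphism with `(id ⊗ ε0) ∘ ρ = id`. -/
structure IsWeakCoaction (ε0 : H0 →ₗ[ℂ] ℂ) (ρ : A →ₗ[ℂ] A ⊗[ℂ] H0) : Prop where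
  map_one : ρ 1 = 1
  map_mul : ∀ a b, ρ (a * b) = ρ a * ρ b
  map_star : ∀ a, ρ (star a) = tstarWith star (ρ a)
  counital : ∀ a, appRight ε0 (ρ a) = a

/-- `ρ : A → A ⊗ H0` is a coaction of `H0` (with comultiplication `Δ0`, counit `ε0`) on `A`:
a weak coaction with `(ρ ⊗ id) ∘ ρ = (id ⊗ Δ0) ∘ ρ`. -/
structure IsCoaction (Δ0 : H0 →ₗ[ℂ] H0 ⊗[ℂ] H0) (ε0 : H0 →ₗ[ℂ] ℂ)
    (ρ : A →ₗ[ℂ] A ⊗[ℂ] H0) extends IsWeakCoaction ε0 ρ : Prop where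
  coassoc : ∀ a, TensorProduct.map ρ LinearMap.id (ρ a)
      = (TensorProduct.assoc ℂ A H0 H0).symm (TensorProduct.map LinearMap.id Δ0 (ρ a))

/-- The pair `(ρ, u)` is a twisted coaction of `H0` on `A`. -/
structure IsTwistedCoaction (Δ0 : H0 →ₗ[ℂ] H0 ⊗[ℂ] H0) (ε0 : H0 →ₗ[ℂ] ℂ)
    (ρ : A →ₗ[ℂ] A ⊗[ℂ] H0) (u : (A ⊗[ℂ] H0) ⊗[ℂ] H0)
    extends IsWeakCoaction ε0 ρ : Prop where
  unitary_left : u * tstarWith (tstarWith star) u = 1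
  unitary_right : tstarWith (tstarWith star) u * u = 1
  twisted_coassoc : ∀ a, TensorProduct.map ρ LinearMap.id (ρ a)
      = u * ((TensorProduct.assoc ℂ A H0 H0).symm (TensorProduct.map LinearMap.id Δ0 (ρ a)))
        * tstarWith (tstarWith star) u
  cocycle : (u ⊗ₜ (1 : H0))
        * TensorProduct.map ((TensorProduct.assoc ℂ A H0 H0).symm.toLinearMap
            ∘ₗ TensorProduct.map LinearMap.id Δ0) LinearMap.id u
      = TensorProduct.map (TensorProduct.map ρ LinearMap.id) LinearMap.id u
        * (TensorProduct.assoc ℂ (A ⊗[ℂ] H0) H0 H0).symm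
            (TensorProduct.map LinearMap.id Δ0 u)
  counit_mid : ∀ h : Module.Dual ℂ H0, appRight h (appRight ε0 u) = h 1 • (1 : A)
  counit_out : ∀ h : Module.Dual ℂ H0, appRight ε0 (appRight h u) = h 1 • (1 : A)

/-- The trivial coaction `a ↦ a ⊗ 1` of `H0` on `A`. -/
def trivialCoaction (H0 : Type u) [Ring H0] [Algebra ℂ H0] (A : Type u) [Ring A]
    [Algebra ℂ A] : A →ₗ[ℂ] A ⊗[ℂ] H0 :=
  (TensorProduct.mk ℂ A H0).flip 1

end Coaction

/-! ### Hilbert bimodules -/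

/-- A (pre-)Hilbert `A`–`B` bimodule structure on `X`: a bimodule with a left `A`-valued and a
right `B`-valued inner product, compatible with the module actions, with the appropriate
(conjugate-)linearity, symmetry, positivity and definiteness properties. -/
structure Bimod (A B X : Type u) [Ring A] [Algebra ℂ A] [StarRing A]
    [Ring B] [Algebra ℂ B] [StarRing B] [AddCommGroup X] [Module ℂ X] where
  ls : A → X → X
  rs : X → B → X
  linn : X → X → A
  rinn : X → X → B
  ls_one : ∀ x, ls 1 x = x
  ls_mul : ∀ a a' x, ls (a * a') x = ls a (ls a' x)
  ls_add : ∀ a a' x, ls (a + a') x = ls a x + ls a' x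
  ls_add' : ∀ a x y, ls a (x + y) = ls a x + ls a y
  ls_smul : ∀ (c : ℂ) a x, ls (c • a) x = c • ls a x
  ls_smul' : ∀ (c : ℂ) a x, ls a (c • x) = c • ls a x
  rs_one : ∀ x, rs x 1 = x
  rs_mul : ∀ x b b', rs x (b * b') = rs (rs x b) b'
  rs_add : ∀ x b b', rs x (b + b') = rs x b + rs x b'
  rs_add' : ∀ x y b, rs (x + y) b = rs x b + rs y b
  rs_smul : ∀ (c : ℂ) x b, rs x (c • b) = c • rs x b
  rs_smul' : ∀ (c : ℂ) x b, rs (c • x) b = c • rs x b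
  ls_rs : ∀ a x b, ls a (rs x b) = rs (ls a x) b
  linn_add_left : ∀ x y z, linn (x + y) z = linn x z + linn y z
  linn_add_right : ∀ x y z, linn x (y + z) = linn x y + linn x z
  rinn_add_left : ∀ x y z, rinn (x + y) z = rinn x z + rinn y z
  rinn_add_right : ∀ x y z, rinn x (y + z) = rinn x y + rinn x z
  linn_smul_left : ∀ (c : ℂ) x y, linn (c • x) y = c • linn x y
  linn_smul_right : ∀ (c : ℂ) x y, linn x (c • y) = starRingEnd ℂ c • linn x y
  rinn_smul_left : ∀ (c : ℂ) x y, rinn (c • x) y = starRingEnd ℂ c • rinn x y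
  rinn_smul_right : ∀ (c : ℂ) x y, rinn x (c • y) = c • rinn x y
  linn_star : ∀ x y, star (linn x y) = linn y x
  rinn_star : ∀ x y, star (rinn x y) = rinn y x
  linn_ls : ∀ a x y, linn (ls a x) y = a * linn x y
  rinn_rs : ∀ x y b, rinn x (rs y b) = rinn x y * b
  linn_rs : ∀ x y b, linn (rs x b) y = linn x (rs y (star b))
  rinn_ls : ∀ a x y, rinn (ls a x) y = rinn x (ls (star a) y)
  linn_pos : ∀ x, ∃ a, linn x x = star a * a
  rinn_pos : ∀ x, ∃ b, rinn x x = star b * b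
  rinn_def : ∀ x, rinn x x = 0 → x = 0

section BimodDefs
variable {A B X : Type u} [Ring A] [Algebra ℂ A] [StarRing A]
    [Ring B] [Algebra ℂ B] [StarRing B] [AddCommGroup X] [Module ℂ X]

/-- A Hilbert bimodule is of finite type if it admits a finite right basis and a finite left
basis in the sense of Kajiwara–Watatani. -/
def Bimod.FiniteType (bm : Bimod A B X) : Prop :=
  (∃ (n : ℕ) (u : Fin n → X), ∀ x, ∑ i, bm.rs (u i) (bm.rinn (u i) x) = x) ∧
  (∃ (m : ℕ) (v : Fin m → X), ∀ x, ∑ j, bm.ls (bm.linn x (v j)) (v j) = x)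

/-- An equivalence bimodule: both inner products are full and the associativity condition
`_A⟨x,y⟩ • z = x • ⟨y,z⟩_B` holds. -/
def Bimod.IsEquivalence (bm : Bimod A B X) : Prop :=
  (∀ x y z, bm.ls (bm.linn x y) z = bm.rs x (bm.rinn y z)) ∧
  Submodule.span ℂ (Set.range fun p : X × X => bm.linn p.1 p.2) = ⊤ ∧
  Submodule.span ℂ (Set.range fun p : X × X => bm.rinn p.1 p.2) = ⊤

end BimodDefs

/-! ### Coactions on Hilbert bimodules, covariant systems, strong Morita equivalence -/

section BimodCoaction
variable {H0 : Type u} [Ring H0] [Algebra ℂ H0] [StarRing H0] [StarModule ℂ H0]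
  [FiniteDimensional ℂ H0]
variable {A B X : Type u} [Ring A] [Algebra ℂ A] [StarRing A]
  [Ring B] [Algebra ℂ B] [StarRing B] [AddCommGroup X] [Module ℂ X]

/-- `(A, B, X, ρ, σ, λ, H0)` is a weak covariant system: `lam` is a weak coaction of `H0` on
the Hilbert `A`–`B` bimodule `X` with respect to `(A, B, ρ, σ)`. -/
structure IsWeakCoactionBimod (ε0 : H0 →ₗ[ℂ] ℂ) (bm : Bimod A B X)
    (ρ : A →ₗ[ℂ] A ⊗[ℂ] H0) (σ : B →ₗ[ℂ] B ⊗[ℂ] H0)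
    (lam : X →ₗ[ℂ] X ⊗[ℂ] H0) : Prop where
  ls_compat : ∀ a x, lam (bm.ls a x) = tact bm.ls (ρ a) (lam x)
  rs_compat : ∀ x b, lam (bm.rs x b) = tact bm.rs (lam x) (σ b)
  linn_compat : ∀ x y, ρ (bm.linn x y) = tinnL bm.linn (lam x) (lam y)
  rinn_compat : ∀ x y, σ (bm.rinn x y) = tinnR bm.rinn (lam x) (lam y)
  counital : ∀ x, appRight ε0 (lam x) = x

/-- `(A, B, X, ρ, σ, λ, H0)` is a covariant system: `lam` is a coaction of `H0` on the
Hilbert `A`–`B` bimodule `X` with respect to `(A, B, ρ, σ)`. -/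
structure IsCoactionBimod (Δ0 : H0 →ₗ[ℂ] H0 ⊗[ℂ] H0) (ε0 : H0 →ₗ[ℂ] ℂ) (bm : Bimod A B X)
    (ρ : A →ₗ[ℂ] A ⊗[ℂ] H0) (σ : B →ₗ[ℂ] B ⊗[ℂ] H0) (lam : X →ₗ[ℂ] X ⊗[ℂ] H0)
    extends IsWeakCoactionBimod ε0 bm ρ σ lam : Prop where
  coassoc : ∀ x, TensorProduct.map lam LinearMap.id (lam x)
      = (TensorProduct.assoc ℂ X H0 H0).symm (TensorProduct.map LinearMap.id Δ0 (lam x))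

/-- `(A, B, X, ρ, u, σ, v, λ, H0)` is a twisted covariant system: `lam` is a twisted coaction
of `H0` on the Hilbert `A`–`B` bimodule `X` with respect to `(A, B, ρ, u, σ, v)`. -/
structure IsTwistedCoactionBimod (Δ0 : H0 →ₗ[ℂ] H0 ⊗[ℂ] H0) (ε0 : H0 →ₗ[ℂ] ℂ)
    (bm : Bimod A B X) (ρ : A →ₗ[ℂ] A ⊗[ℂ] H0) (u : (A ⊗[ℂ] H0) ⊗[ℂ] H0)
    (σ : B →ₗ[ℂ] B ⊗[ℂ] H0) (v : (B ⊗[ℂ] H0) ⊗[ℂ] H0) (lam : X →ₗ[ℂ] X ⊗[ℂ] H0)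
    extends IsWeakCoactionBimod ε0 bm ρ σ lam : Prop where
  twisted : ∀ x, TensorProduct.map lam LinearMap.id (lam x)
      = tact (tact bm.rs)
          (tact (tact bm.ls) u
            ((TensorProduct.assoc ℂ X H0 H0).symm (TensorProduct.map LinearMap.id Δ0 (lam x))))
          (tstarWith (tstarWith star) v)

/-- Two weak coactions `ρ` (on `A`) and `σ` (on `B`) of `H0` are strongly Morita equivalent
if there are an `A`–`B` equivalence bimodule `X` and a weak coaction of `H0` on `X` with
respect to `(A, B, ρ, σ)`. -/
def WeakSME (ε0 : H0 →ₗ[ℂ] ℂ) (ρ : A →ₗ[ℂ] A ⊗[ℂ] H0) (σ : B →ₗ[ℂ] B ⊗[ℂ] H0) : Prop :=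
  ∃ (X : Type u) (_ : AddCommGroup X) (_ : Module ℂ X) (bm : Bimod A B X),
    bm.IsEquivalence ∧ ∃ lam : X →ₗ[ℂ] X ⊗[ℂ] H0, IsWeakCoactionBimod ε0 bm ρ σ lam

/-- Two coactions `ρ` (on `A`) and `σ` (on `B`) of `H0` are strongly Morita equivalent if
there are an `A`–`B` equivalence bimodule `X` and a coaction of `H0` on `X` with respect to
`(A, B, ρ, σ)`. -/
def CoactSME (Δ0 : H0 →ₗ[ℂ] H0 ⊗[ℂ] H0) (ε0 : H0 →ₗ[ℂ] ℂ)
    (ρ : A →ₗ[ℂ] A ⊗[ℂ] H0) (σ : B →ₗ[ℂ] B ⊗[ℂ] H0) : Prop :=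
  ∃ (X : Type u) (_ : AddCommGroup X) (_ : Module ℂ X) (bm : Bimod A B X),
    bm.IsEquivalence ∧ ∃ lam : X →ₗ[ℂ] X ⊗[ℂ] H0, IsCoactionBimod Δ0 ε0 bm ρ σ lam

/-- Two twisted coactions `(ρ, u)` (on `A`) and `(σ, v)` (on `B`) of `H0` are strongly Morita
equivalent if there are an `A`–`B` equivalence bimodule `X` and a twisted coaction of `H0` on
`X` with respect to `(A, B, ρ, u, σ, v)`. -/
def TwistedSME (Δ0 : H0 →ₗ[ℂ] H0 ⊗[ℂ] H0) (ε0 : H0 →ₗ[ℂ] ℂ)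
    (ρ : A →ₗ[ℂ] A ⊗[ℂ] H0) (u : (A ⊗[ℂ] H0) ⊗[ℂ] H0)
    (σ : B →ₗ[ℂ] B ⊗[ℂ] H0) (v : (B ⊗[ℂ] H0) ⊗[ℂ] H0) : Prop :=
  ∃ (X : Type u) (_ : AddCommGroup X) (_ : Module ℂ X) (bm : Bimod A B X),
    bm.IsEquivalence ∧
      ∃ lam : X →ₗ[ℂ] X ⊗[ℂ] H0, IsTwistedCoactionBimod Δ0 ε0 bm ρ u σ v lam

end BimodCoaction
/-! ### Inner and strongly inner coactions -/

section Inner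
variable {H0 : Type u} [Ring H0] [Algebra ℂ H0] [StarRing H0] [StarModule ℂ H0]
  [FiniteDimensional ℂ H0]
variable {A : Type u} [Ring A] [Algebra ℂ A] [StarRing A]

/-- The convolution product of two functionals `h, l` on `H0`:
`(hl)(φ) = (h ⊗ l)(Δ0 φ)`. -/
def dualMul (Δ0 : H0 →ₗ[ℂ] H0 ⊗[ℂ] H0) (h l : Module.Dual ℂ H0) : Module.Dual ℂ H0 :=
  LinearMap.mul' ℂ ℂ ∘ₗ TensorProduct.map h l ∘ₗ Δ0

/-- A weak coaction `ρ` of `H0` on `A` is inner: there is a unitary `w ∈ A ⊗ H0` with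
`ρ = Ad(w) ∘ ρ⁰` (where `ρ⁰` is the trivial coaction) and `(id ⊗ ε0)(w) = 1`. -/
def IsInnerCoaction (ε0 : H0 →ₗ[ℂ] ℂ) (ρ : A →ₗ[ℂ] A ⊗[ℂ] H0) : Prop :=
  ∃ w : A ⊗[ℂ] H0, w * tstarWith star w = 1 ∧ tstarWith star w * w = 1 ∧
    (∀ a, ρ a = w * (a ⊗ₜ (1 : H0)) * tstarWith star w) ∧ appRight ε0 w = 1

/-- A coaction `ρ` of `H0` on `A` is strongly inner: it is implemented as `Ad(w) ∘ ρ⁰` by a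
unitary `w ∈ A ⊗ H0` with `(id ⊗ ε0)(w) = 1` such that moreover `ŵ(hl) = ŵ(h)ŵ(l)` for all
`h, l ∈ H = (H0)^*`, where `ŵ(h) = (id ⊗ h)(w)`. -/
def IsStronglyInnerCoaction (Δ0 : H0 →ₗ[ℂ] H0 ⊗[ℂ] H0) (ε0 : H0 →ₗ[ℂ] ℂ)
    (ρ : A →ₗ[ℂ] A ⊗[ℂ] H0) : Prop :=
  ∃ w : A ⊗[ℂ] H0, w * tstarWith star w = 1 ∧ tstarWith star w * w = 1 ∧
    (∀ a, ρ a = w * (a ⊗ₜ (1 : H0)) * tstarWith star w) ∧ appRight ε0 w = 1 ∧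
    ∀ h l : Module.Dual ℂ H0,
      appRight (dualMul Δ0 h l) w = appRight h w * appRight l w

end Inner

/-! ### Outer coactions -/

/-- `π : H0 → K0` is a homomorphism of C*-Hopf algebras: a unital ⋆-algebra homomorphism
intertwining the comultiplications and the counits. -/
structure IsHopfHom {H0 K0 : Type u}
    [Ring H0] [Algebra ℂ H0] [StarRing H0] [StarModule ℂ H0] [FiniteDimensional ℂ H0]
    [Ring K0] [Algebra ℂ K0] [StarRing K0] [StarModule ℂ K0] [FiniteDimensional ℂ K0]
    (dH0 : HopfAlgData H0) (dK0 : HopfAlgData K0) (π : H0 →ₐ[ℂ] K0) : Prop where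
  map_star : ∀ φ, π (star φ) = star (π φ)
  comul_compat : ∀ φ, dK0.comul (π φ)
      = TensorProduct.map π.toLinearMap π.toLinearMap (dH0.comul φ)
  counit_compat : ∀ φ, dK0.counit (π φ) = dH0.counit φ

/-- A coaction `ρ` of `H0` on `A` is outer if for every surjective C*-Hopf algebra
homomorphism `π` of `H0` onto a non-trivial C*-Hopf algebra `K0`, the induced coaction
`(id ⊗ π) ∘ ρ` of `K0` on `A` is not inner. -/
def IsOuterCoaction {H0 A : Type u}
    [Ring H0] [Algebra ℂ H0] [StarRing H0] [StarModule ℂ H0] [FiniteDimensional ℂ H0]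
    [Ring A] [Algebra ℂ A] [StarRing A]
    (dH0 : HopfAlgData H0) (ρ : A →ₗ[ℂ] A ⊗[ℂ] H0) : Prop :=
  ∀ (K0 : Type u) (_ : CStarAlgebra K0) (_ : StarModule ℂ K0) (_ : FiniteDimensional ℂ K0)
    (dK0 : HopfAlgData K0) (π : H0 →ₐ[ℂ] K0),
    IsHopfHom dH0 dK0 π → Function.Surjective π → 1 < Module.finrank ℂ K0 →
    ¬ IsInnerCoaction dK0.counit.toLinearMap
        (TensorProduct.map LinearMap.id π.toLinearMap ∘ₗ ρ)

/-! ### Calculus of the operations on tensor products -/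

section TensorCalculus

/-- A map `P → Q → R` of complex vector spaces which is `s₁`-semilinear in the first and
`s₂`-semilinear in the second variable. -/
structure IsSesq (s₁ s₂ : ℂ →+* ℂ) {P Q R : Type*} [AddCommGroup P] [Module ℂ P]
    [AddCommGroup Q] [Module ℂ Q] [AddCommGroup R] [Module ℂ R] (op : P → Q → R) : Prop where
  add_left : ∀ p p' q, op (p + p') q = op p q + op p' q
  add_right : ∀ p q q', op p (q + q') = op p q + op p q'
  smul_left : ∀ (c : ℂ) p q, op (c • p) q = s₁ c • op p q
  smul_right : ∀ (c : ℂ) p q, op p (c • q) = s₂ c • op p q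

variable {P Q R C D : Type*} [AddCommGroup P] [Module ℂ P] [AddCommGroup Q] [Module ℂ Q]
  [AddCommGroup R] [Module ℂ R]

namespace IsSesq

variable {s₁ s₂ : ℂ →+* ℂ} {op : P → Q → R}

/-- The bundled version of a sesquilinear operation. -/
def toLin (h : IsSesq s₁ s₂ op) : P →ₛₗ[s₁] Q →ₛₗ[s₂] R :=
  LinearMap.mk₂'ₛₗ s₁ s₂ op h.add_left h.smul_left h.add_right h.smul_right

lemma toLin_apply (h : IsSesq s₁ s₂ op) (p : P) (q : Q) : h.toLin p q = op p q := rfl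

lemma zero_left (h : IsSesq s₁ s₂ op) (q : Q) : op 0 q = 0 := by
  simp [← h.toLin_apply]

lemma zero_right (h : IsSesq s₁ s₂ op) (p : P) : op p 0 = 0 := by
  simp [← h.toLin_apply]

lemma sum_left (h : IsSesq s₁ s₂ op) {ι : Type*} (s : Finset ι) (f : ι → P) (q : Q) :
    op (∑ i ∈ s, f i) q = ∑ i ∈ s, op (f i) q := by
  simp [← h.toLin_apply]

lemma sum_right (h : IsSesq s₁ s₂ op) {ι : Type*} (s : Finset ι) (p : P) (f : ι → Q) :
    op p (∑ i ∈ s, f i) = ∑ i ∈ s, op p (f i) := by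
  simp [← h.toLin_apply]

end IsSesq

@[simp] lemma appRight_tmul {M C : Type*} [AddCommGroup M] [Module ℂ M] [AddCommGroup C]
    [Module ℂ C] (f : C →ₗ[ℂ] ℂ) (m : M) (c : C) : appRight f (m ⊗ₜ[ℂ] c) = f c • m := by
  simp [appRight]

section
variable [Ring C] [Algebra ℂ C] [FiniteDimensional ℂ C]

@[simp] lemma tcoord_tmul (i : Fin (Module.finrank ℂ C)) (m : P) (c : C) :
    tcoord i (m ⊗ₜ[ℂ] c) = (Module.finBasis ℂ C).repr c i • m := by
  simp [tcoord]

variable {s₁ s₂ : ℂ →+* ℂ} {op : P → Q → R} {cop : C → C → C}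

lemma tmix_add_left (h : IsSesq s₁ s₂ op) (s s' : P ⊗[ℂ] C) (t : Q ⊗[ℂ] C) :
    tmix op cop (s + s') t = tmix op cop s t + tmix op cop s' t := by
  simp [tmix, h.add_left, TensorProduct.add_tmul, Finset.sum_add_distrib]

lemma tmix_add_right (h : IsSesq s₁ s₂ op) (s : P ⊗[ℂ] C) (t t' : Q ⊗[ℂ] C) :
    tmix op cop s (t + t') = tmix op cop s t + tmix op cop s t' := by
  simp [tmix, h.add_right, TensorProduct.add_tmul, Finset.sum_add_distrib]

lemma tmix_tmul (h : IsSesq s₁ s₂ op) (hc : IsSesq s₁ s₂ cop) (p : P) (q : Q) (c d : C) :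
    tmix op cop (p ⊗ₜ c) (q ⊗ₜ d) = op p q ⊗ₜ[ℂ] cop c d := by
  conv_rhs => rw [← (Module.finBasis ℂ C).sum_repr c, ← (Module.finBasis ℂ C).sum_repr d,
    hc.sum_left]
  simp only [hc.sum_right, hc.smul_left, hc.smul_right, TensorProduct.tmul_sum, tmix,
    tcoord_tmul, h.smul_left, h.smul_right, TensorProduct.smul_tmul', TensorProduct.tmul_smul]

lemma isSesq_tmix (h : IsSesq s₁ s₂ op) : IsSesq s₁ s₂ (tmix (C := C) op cop) where
  add_left := tmix_add_left h
  add_right := tmix_add_right h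
  smul_left c s t := by
    simp [tmix, h.smul_left, TensorProduct.smul_tmul', Finset.smul_sum]
  smul_right c s t := by
    simp [tmix, h.smul_right, TensorProduct.smul_tmul', Finset.smul_sum]

lemma map_tmix [Ring D] [Algebra ℂ D] [FiniteDimensional ℂ D] {cop' : D → D → D}
    (h : IsSesq s₁ s₂ op) (hc : IsSesq s₁ s₂ cop) (hc' : IsSesq s₁ s₂ cop') (π : C →ₗ[ℂ] D)
    (hπ : ∀ c d, π (cop c d) = cop' (π c) (π d)) (s : P ⊗[ℂ] C) (t : Q ⊗[ℂ] C) :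
    TensorProduct.map LinearMap.id π (tmix op cop s t)
      = tmix op cop' (TensorProduct.map LinearMap.id π s) (TensorProduct.map LinearMap.id π t) := by
  have hC := isSesq_tmix (C := C) (cop := cop) h
  have hD := isSesq_tmix (C := D) (cop := cop') h
  induction s with
  | zero => simp [hC.zero_left, hD.zero_left]
  | add s s' hs hs' => simp [hC.add_left, hD.add_left, hs, hs']
  | tmul p c =>
    induction t with
    | zero => simp [hC.zero_right, hD.zero_right]
    | add t t' ht ht' => simp [hC.add_right, hD.add_right, ht, ht']
    | tmul q d => simp [tmix_tmul h hc, tmix_tmul h hc', hπ]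

lemma appRight_tmix (h : IsSesq s₁ s₂ op) (hc : IsSesq s₁ s₂ cop) (ε : C →ₗ[ℂ] ℂ)
    (hε : ∀ c d, ε (cop c d) = s₁ (ε c) * s₂ (ε d)) (s : P ⊗[ℂ] C) (t : Q ⊗[ℂ] C) :
    appRight ε (tmix op cop s t) = op (appRight ε s) (appRight ε t) := by
  have hC := isSesq_tmix (C := C) (cop := cop) h
  induction s with
  | zero => simp [hC.zero_left, h.zero_left]
  | add s s' hs hs' => simp [hC.add_left, h.add_left, hs, hs']
  | tmul p c =>
    induction t with
    | zero => simp [hC.zero_right, h.zero_right]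
    | add t t' ht ht' => simp [hC.add_right, h.add_right, ht, ht']
    | tmul q d => simp [tmix_tmul h hc, hε, h.smul_left, h.smul_right, mul_smul]

lemma isSesq_mul : IsSesq (.id ℂ) (.id ℂ) (fun c d : C => c * d) where
  add_left := add_mul
  add_right := mul_add
  smul_left := by simp
  smul_right := by simp

variable [StarRing C] [StarModule ℂ C]

lemma isSesq_mul_star : IsSesq (.id ℂ) (starRingEnd ℂ) (fun c d : C => c * star d) where
  add_left := by simp [add_mul]
  add_right := by simp [mul_add]
  smul_left := by simp
  smul_right := by simp

lemma isSesq_star_mul : IsSesq (starRingEnd ℂ) (.id ℂ) (fun c d : C => star c * d) where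
  add_left := by simp [add_mul]
  add_right := by simp [mul_add]
  smul_left := by simp
  smul_right := by simp

end

section Star
variable [Ring C] [Algebra ℂ C] [FiniteDimensional ℂ C] [StarRing C] [StarModule ℂ C]
  {A : Type*} [Ring A] [Algebra ℂ A] [StarRing A] [StarModule ℂ A]

@[simp] lemma tstarWith_add (s t : A ⊗[ℂ] C) :
    tstarWith star (s + t) = tstarWith star s + tstarWith star t := by
  simp [tstarWith, TensorProduct.add_tmul, Finset.sum_add_distrib]

@[simp] lemma tstarWith_zero : tstarWith star (0 : A ⊗[ℂ] C) = 0 := by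
  simp [tstarWith]

@[simp] lemma tstarWith_tmul (a : A) (c : C) :
    tstarWith star (a ⊗ₜ[ℂ] c) = star a ⊗ₜ star c := by
  conv_rhs => rw [← (Module.finBasis ℂ C).sum_repr c, star_sum, TensorProduct.tmul_sum]
  simp [tstarWith, TensorProduct.smul_tmul']

@[simp] lemma tstarWith_tstarWith (s : A ⊗[ℂ] C) : tstarWith star (tstarWith star s) = s := by
  induction s with
  | zero => simp
  | add s t hs ht => simp [hs, ht]
  | tmul a c => simp

lemma appRight_tstarWith (ε : C →ₗ[ℂ] ℂ) (hε : ∀ c, ε (star c) = starRingEnd ℂ (ε c))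
    (s : A ⊗[ℂ] C) : appRight ε (tstarWith star s) = star (appRight ε s) := by
  induction s with
  | zero => simp
  | add s t hs ht => simp [hs, ht]
  | tmul a c => simp [hε]

end Star

end TensorCalculus

/-! ### The Hilbert bimodule `X ⊗ C` -/

section BimodTensor

variable {A B X : Type u} [Ring A] [Algebra ℂ A] [StarRing A]
  [Ring B] [Algebra ℂ B] [StarRing B] [AddCommGroup X] [Module ℂ X]

namespace Bimod

variable (bm : Bimod A B X)

lemma isSesq_ls : IsSesq (.id ℂ) (.id ℂ) bm.ls :=
  ⟨bm.ls_add, bm.ls_add', bm.ls_smul, bm.ls_smul'⟩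

lemma isSesq_rs : IsSesq (.id ℂ) (.id ℂ) bm.rs :=
  ⟨bm.rs_add', bm.rs_add, bm.rs_smul', bm.rs_smul⟩

lemma isSesq_linn : IsSesq (.id ℂ) (starRingEnd ℂ) bm.linn :=
  ⟨bm.linn_add_left, bm.linn_add_right, bm.linn_smul_left, bm.linn_smul_right⟩

lemma isSesq_rinn : IsSesq (starRingEnd ℂ) (.id ℂ) bm.rinn :=
  ⟨bm.rinn_add_left, bm.rinn_add_right, bm.rinn_smul_left, bm.rinn_smul_right⟩

lemma linn_rs_right (x y : X) (b : B) :
    bm.linn x (bm.rs y b) = bm.linn (bm.rs x (star b)) y := by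
  simp [bm.linn_rs]

lemma linn_ls_right (a : A) (x y : X) : bm.linn x (bm.ls a y) = bm.linn x y * star a := by
  rw [← bm.linn_star, bm.linn_ls, star_mul, bm.linn_star]

lemma rinn_rs_left (x y : X) (b : B) : bm.rinn (bm.rs x b) y = star b * bm.rinn x y := by
  rw [← bm.rinn_star, bm.rinn_rs, star_mul, bm.rinn_star]

variable {C : Type u} [Ring C] [Algebra ℂ C] [FiniteDimensional ℂ C]

lemma isSesq_tact_ls : IsSesq (.id ℂ) (.id ℂ) (tact (C := C) bm.ls) := isSesq_tmix bm.isSesq_ls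

lemma isSesq_tact_rs : IsSesq (.id ℂ) (.id ℂ) (tact (C := C) bm.rs) := isSesq_tmix bm.isSesq_rs

@[simp] lemma tact_ls_tmul (a : A) (x : X) (c d : C) :
    tact bm.ls (a ⊗ₜ c) (x ⊗ₜ d) = bm.ls a x ⊗ₜ[ℂ] (c * d) :=
  tmix_tmul bm.isSesq_ls isSesq_mul _ _ _ _

@[simp] lemma tact_rs_tmul (b : B) (x : X) (c d : C) :
    tact bm.rs (x ⊗ₜ c) (b ⊗ₜ d) = bm.rs x b ⊗ₜ[ℂ] (c * d) :=
  tmix_tmul bm.isSesq_rs isSesq_mul _ _ _ _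

lemma tact_ls_mul (s t : A ⊗[ℂ] C) (x : X ⊗[ℂ] C) :
    tact bm.ls (s * t) x = tact bm.ls s (tact bm.ls t x) := by
  have h := bm.isSesq_tact_ls (C := C)
  induction s with
  | zero => simp [h.zero_left]
  | add s s' hs hs' => simp [add_mul, h.add_left, hs, hs']
  | tmul a c =>
    induction t with
    | zero => simp [h.zero_left, h.zero_right]
    | add t t' ht ht' => simp [mul_add, h.add_left, h.add_right, ht, ht']
    | tmul a' c' =>
      induction x with
      | zero => simp [h.zero_right]
      | add x x' hx hx' => simp only [h.add_right, hx, hx']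
      | tmul x d => simp [bm.ls_mul, mul_assoc]

lemma tact_rs_mul (x : X ⊗[ℂ] C) (s t : B ⊗[ℂ] C) :
    tact bm.rs x (s * t) = tact bm.rs (tact bm.rs x s) t := by
  have h := bm.isSesq_tact_rs (C := C)
  induction s with
  | zero => simp [h.zero_left, h.zero_right]
  | add s s' hs hs' => simp [add_mul, h.add_left, h.add_right, hs, hs']
  | tmul a c =>
    induction t with
    | zero => simp [h.zero_right]
    | add t t' ht ht' => simp [mul_add, h.add_right, ht, ht']
    | tmul a' c' =>
      induction x with
      | zero => simp [h.zero_left]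
      | add x x' hx hx' => simp only [h.add_left, hx, hx']
      | tmul x d => simp [bm.rs_mul, mul_assoc]

lemma tact_ls_one (x : X ⊗[ℂ] C) : tact bm.ls 1 x = x := by
  have h := bm.isSesq_tact_ls (C := C)
  induction x with
  | zero => simp [h.zero_right]
  | add x x' hx hx' => simp only [h.add_right, hx, hx']
  | tmul x d => simp [Algebra.TensorProduct.one_def, bm.ls_one]

lemma tact_rs_one (x : X ⊗[ℂ] C) : tact bm.rs x 1 = x := by
  have h := bm.isSesq_tact_rs (C := C)
  induction x with
  | zero => simp [h.zero_left]
  | add x x' hx hx' => simp only [h.add_left, hx, hx']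
  | tmul x d => simp [Algebra.TensorProduct.one_def, bm.rs_one]

lemma appRight_tact_ls (ε : C →ₐ[ℂ] ℂ) (s : A ⊗[ℂ] C) (x : X ⊗[ℂ] C) :
    appRight ε.toLinearMap (tact bm.ls s x)
      = bm.ls (appRight ε.toLinearMap s) (appRight ε.toLinearMap x) :=
  appRight_tmix bm.isSesq_ls isSesq_mul _ (by simp) _ _

lemma appRight_tact_rs (ε : C →ₐ[ℂ] ℂ) (x : X ⊗[ℂ] C) (t : B ⊗[ℂ] C) :
    appRight ε.toLinearMap (tact bm.rs x t)
      = bm.rs (appRight ε.toLinearMap x) (appRight ε.toLinearMap t) :=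
  appRight_tmix bm.isSesq_rs isSesq_mul _ (by simp) _ _

variable [StarRing C] [StarModule ℂ C]

lemma isSesq_tinnL : IsSesq (.id ℂ) (starRingEnd ℂ) (tinnL (C := C) bm.linn) :=
  isSesq_tmix bm.isSesq_linn

lemma isSesq_tinnR : IsSesq (starRingEnd ℂ) (.id ℂ) (tinnR (C := C) bm.rinn) :=
  isSesq_tmix bm.isSesq_rinn

@[simp] lemma tinnL_tmul (x y : X) (c d : C) :
    tinnL bm.linn (x ⊗ₜ c) (y ⊗ₜ d) = bm.linn x y ⊗ₜ[ℂ] (c * star d) :=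
  tmix_tmul bm.isSesq_linn isSesq_mul_star _ _ _ _

@[simp] lemma tinnR_tmul (x y : X) (c d : C) :
    tinnR bm.rinn (x ⊗ₜ c) (y ⊗ₜ d) = bm.rinn x y ⊗ₜ[ℂ] (star c * d) :=
  tmix_tmul bm.isSesq_rinn isSesq_star_mul _ _ _ _

lemma tinnL_ls (s : A ⊗[ℂ] C) (x y : X ⊗[ℂ] C) :
    tinnL bm.linn (tact bm.ls s x) y = s * tinnL bm.linn x y := by
  have h := bm.isSesq_tact_ls (C := C)
  have h' := bm.isSesq_tinnL (C := C)
  induction s with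
  | zero => simp [h.zero_left, h'.zero_left]
  | add s s' hs hs' => simp [h.add_left, h'.add_left, add_mul, hs, hs']
  | tmul a c =>
    induction x with
    | zero => simp [h.zero_right, h'.zero_left]
    | add x x' hx hx' => simp [h.add_right, h'.add_left, mul_add, hx, hx']
    | tmul x d =>
      induction y with
      | zero => simp [h'.zero_right]
      | add y y' hy hy' => simp only [h'.add_right, mul_add, hy, hy']
      | tmul y e => simp [bm.linn_ls, mul_assoc]

lemma tinnR_rs (x y : X ⊗[ℂ] C) (t : B ⊗[ℂ] C) :
    tinnR bm.rinn x (tact bm.rs y t) = tinnR bm.rinn x y * t := by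
  have h := bm.isSesq_tact_rs (C := C)
  have h' := bm.isSesq_tinnR (C := C)
  induction t with
  | zero => simp [h.zero_right, h'.zero_right]
  | add s s' hs hs' => simp [h.add_right, h'.add_right, mul_add, hs, hs']
  | tmul a c =>
    induction x with
    | zero => simp [h'.zero_left]
    | add x x' hx hx' => simp [h'.add_left, add_mul, hx, hx']
    | tmul x d =>
      induction y with
      | zero => simp [h.zero_left, h'.zero_right]
      | add y y' hy hy' => simp only [h.add_left, h'.add_right, add_mul, hy, hy']
      | tmul y e => simp [bm.rinn_rs, mul_assoc]

variable [StarModule ℂ A] [StarModule ℂ B]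

lemma tinnL_ls_right (s : A ⊗[ℂ] C) (x y : X ⊗[ℂ] C) :
    tinnL bm.linn x (tact bm.ls s y) = tinnL bm.linn x y * tstarWith star s := by
  have h := bm.isSesq_tact_ls (C := C)
  have h' := bm.isSesq_tinnL (C := C)
  induction s with
  | zero => simp [h.zero_left, h'.zero_right]
  | add s s' hs hs' => simp [h.add_left, h'.add_right, mul_add, hs, hs']
  | tmul a c =>
    induction x with
    | zero => simp [h'.zero_left]
    | add x x' hx hx' => simp only [h'.add_left, add_mul, hx, hx']
    | tmul x d =>
      induction y with
      | zero => simp [h.zero_right, h'.zero_right]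
      | add y y' hy hy' => simp only [h.add_right, h'.add_right, add_mul, hy, hy']
      | tmul y e => simp [bm.linn_ls_right, mul_assoc]

lemma tinnR_rs_left (x y : X ⊗[ℂ] C) (t : B ⊗[ℂ] C) :
    tinnR bm.rinn (tact bm.rs x t) y = tstarWith star t * tinnR bm.rinn x y := by
  have h := bm.isSesq_tact_rs (C := C)
  have h' := bm.isSesq_tinnR (C := C)
  induction t with
  | zero => simp [h.zero_right, h'.zero_left]
  | add s s' hs hs' => simp [h.add_right, h'.add_left, add_mul, hs, hs']
  | tmul a c =>
    induction x with
    | zero => simp [h.zero_left, h'.zero_left]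
    | add x x' hx hx' => simp only [h.add_left, h'.add_left, mul_add, hx, hx']
    | tmul x d =>
      induction y with
      | zero => simp [h'.zero_right]
      | add y y' hy hy' => simp only [h'.add_right, mul_add, hy, hy']
      | tmul y e => simp [bm.rinn_rs_left, mul_assoc]

lemma tinnL_rs_right (x y : X ⊗[ℂ] C) (t : B ⊗[ℂ] C) :
    tinnL bm.linn x (tact bm.rs y t) = tinnL bm.linn (tact bm.rs x (tstarWith star t)) y := by
  have h := bm.isSesq_tact_rs (C := C)
  have h' := bm.isSesq_tinnL (C := C)
  induction t with
  | zero => simp [h.zero_right, h'.zero_right, h'.zero_left]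
  | add s s' hs hs' => simp [h.add_right, h'.add_left, h'.add_right, hs, hs']
  | tmul a c =>
    induction x with
    | zero => simp [h.zero_left, h'.zero_left]
    | add x x' hx hx' => simp only [h.add_left, h'.add_left, hx, hx']
    | tmul x d =>
      induction y with
      | zero => simp [h.zero_left, h'.zero_right]
      | add y y' hy hy' => simp only [h.add_left, h'.add_right, hy, hy']
      | tmul y e => simp [bm.linn_rs_right, mul_assoc]

lemma tinnR_ls_left (s : A ⊗[ℂ] C) (x y : X ⊗[ℂ] C) :
    tinnR bm.rinn (tact bm.ls s x) y = tinnR bm.rinn x (tact bm.ls (tstarWith star s) y) := by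
  have h := bm.isSesq_tact_ls (C := C)
  have h' := bm.isSesq_tinnR (C := C)
  induction s with
  | zero => simp [h.zero_left, h'.zero_right, h'.zero_left]
  | add s s' hs hs' => simp [h.add_left, h'.add_left, h'.add_right, hs, hs']
  | tmul a c =>
    induction x with
    | zero => simp [h.zero_right, h'.zero_left]
    | add x x' hx hx' => simp only [h.add_right, h'.add_left, hx, hx']
    | tmul x d =>
      induction y with
      | zero => simp [h.zero_right, h'.zero_right]
      | add y y' hy hy' => simp only [h.add_right, h'.add_right, hy, hy']
      | tmul y e => simp [bm.rinn_ls, mul_assoc]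


section Equivalence

variable {bm}

lemma IsEquivalence.tact_linn (h : bm.IsEquivalence) (x y z : X ⊗[ℂ] C) :
    tact bm.ls (tinnL bm.linn x y) z = tact bm.rs x (tinnR bm.rinn y z) := by
  have hl := bm.isSesq_tact_ls (C := C)
  have hr := bm.isSesq_tact_rs (C := C)
  have hL := bm.isSesq_tinnL (C := C)
  have hR := bm.isSesq_tinnR (C := C)
  induction x with
  | zero => simp [hl.zero_left, hr.zero_left, hL.zero_left]
  | add x x' hx hx' => simp only [hl.add_left, hr.add_left, hL.add_left, hx, hx']
  | tmul x c =>
    induction y with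
    | zero => simp [hl.zero_left, hr.zero_right, hL.zero_right, hR.zero_left]
    | add y y' hy hy' =>
      simp only [hl.add_left, hr.add_right, hL.add_right, hR.add_left, hy, hy']
    | tmul y d =>
      induction z with
      | zero => simp [hl.zero_right, hr.zero_right, hR.zero_right]
      | add z z' hz hz' => simp only [hl.add_right, hr.add_right, hR.add_right, hz, hz']
      | tmul z e => simp [h.1, mul_assoc]

lemma IsEquivalence.exists_sum_linn (h : bm.IsEquivalence) :
    ∃ (s : Finset (X × X)) (u v : X × X → X), ∑ p ∈ s, bm.linn (u p) (v p) = 1 := by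
  have h1 : (1 : A) ∈ Submodule.span ℂ (Set.range fun p : X × X => bm.linn p.1 p.2) := by
    rw [h.2.1]; trivial
  obtain ⟨c, hc⟩ := Finsupp.mem_span_range_iff_exists_finsupp.1 h1
  exact ⟨c.support, fun p => c p • p.1, fun p => p.2, by
    simpa [bm.linn_smul_left, Finsupp.sum] using hc⟩

lemma IsEquivalence.exists_sum_rinn (h : bm.IsEquivalence) :
    ∃ (s : Finset (X × X)) (u v : X × X → X), ∑ p ∈ s, bm.rinn (u p) (v p) = 1 := by
  have h1 : (1 : B) ∈ Submodule.span ℂ (Set.range fun p : X × X => bm.rinn p.1 p.2) := by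
    rw [h.2.2]; trivial
  obtain ⟨c, hc⟩ := Finsupp.mem_span_range_iff_exists_finsupp.1 h1
  exact ⟨c.support, fun p => p.1, fun p => c p • p.2, by
    simpa [bm.rinn_smul_right, Finsupp.sum] using hc⟩

lemma IsEquivalence.linearMap_ext_linn (h : bm.IsEquivalence) {M : Type*} [AddCommGroup M]
    [Module ℂ M] {f g : A →ₗ[ℂ] M} (hfg : ∀ x y, f (bm.linn x y) = g (bm.linn x y)) : f = g :=
  LinearMap.ext_on_range h.2.1 fun p => hfg p.1 p.2

lemma IsEquivalence.linearMap_ext_rinn (h : bm.IsEquivalence) {M : Type*} [AddCommGroup M]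
    [Module ℂ M] {f g : B →ₗ[ℂ] M} (hfg : ∀ x y, f (bm.rinn x y) = g (bm.rinn x y)) : f = g :=
  LinearMap.ext_on_range h.2.2 fun p => hfg p.1 p.2

/-- The right action of `B ⊗ C` on `X ⊗ C` is faithful, already on `X ⊗ 1`. -/
lemma IsEquivalence.eq_of_tact_rs (h : bm.IsEquivalence) {s t : B ⊗[ℂ] C}
    (hst : ∀ x : X, tact bm.rs (x ⊗ₜ (1 : C)) s = tact bm.rs (x ⊗ₜ (1 : C)) t) : s = t := by
  obtain ⟨I, u, v, huv⟩ := h.exists_sum_rinn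
  have key : ∀ r : B ⊗[ℂ] C, r = ∑ p ∈ I,
      tinnR bm.rinn (u p ⊗ₜ (1 : C)) (tact bm.rs (v p ⊗ₜ (1 : C)) r) := fun r => by
    simp only [tinnR_rs, ← Finset.sum_mul, tinnR_tmul, star_one, mul_one,
      ← TensorProduct.sum_tmul, huv, ← Algebra.TensorProduct.one_def, one_mul]
  rw [key s, key t]
  simp only [hst]

/-- The left action of `A ⊗ C` on `X ⊗ C` is faithful, already on `X ⊗ 1`. -/
lemma IsEquivalence.eq_of_tact_ls (h : bm.IsEquivalence) {s t : A ⊗[ℂ] C}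
    (hst : ∀ x : X, tact bm.ls s (x ⊗ₜ (1 : C)) = tact bm.ls t (x ⊗ₜ (1 : C))) : s = t := by
  obtain ⟨I, u, v, huv⟩ := h.exists_sum_linn
  have key : ∀ r : A ⊗[ℂ] C, r = ∑ p ∈ I,
      tinnL bm.linn (tact bm.ls r (u p ⊗ₜ (1 : C))) (v p ⊗ₜ (1 : C)) := fun r => by
    simp only [tinnL_ls, ← Finset.mul_sum, tinnL_tmul, star_one, mul_one,
      ← TensorProduct.sum_tmul, huv, ← Algebra.TensorProduct.one_def]
  rw [key s, key t]
  simp only [hst]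

/-- An element of `X ⊗ C` is determined by its left inner products with `X ⊗ 1`. -/
lemma IsEquivalence.eq_of_tinnL (h : bm.IsEquivalence) {x y : X ⊗[ℂ] C}
    (hxy : ∀ z : X, tinnL bm.linn x (z ⊗ₜ (1 : C)) = tinnL bm.linn y (z ⊗ₜ (1 : C))) : x = y := by
  obtain ⟨I, u, v, huv⟩ := h.exists_sum_rinn
  have key : ∀ r : X ⊗[ℂ] C, r = ∑ p ∈ I,
      tact bm.ls (tinnL bm.linn r (u p ⊗ₜ (1 : C))) (v p ⊗ₜ (1 : C)) := fun r => by
    simp only [h.tact_linn, ← bm.isSesq_tact_rs.sum_right, tinnR_tmul, star_one, mul_one,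
      ← TensorProduct.sum_tmul, huv, ← Algebra.TensorProduct.one_def, tact_rs_one]
  rw [key x, key y]
  simp only [hxy]

/-- An element of `X ⊗ C` is determined by its right inner products with `X ⊗ 1`. -/
lemma IsEquivalence.eq_of_tinnR (h : bm.IsEquivalence) {x y : X ⊗[ℂ] C}
    (hxy : ∀ z : X, tinnR bm.rinn (z ⊗ₜ (1 : C)) x = tinnR bm.rinn (z ⊗ₜ (1 : C)) y) : x = y := by
  obtain ⟨I, u, v, huv⟩ := h.exists_sum_linn
  have key : ∀ r : X ⊗[ℂ] C, r = ∑ p ∈ I,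
      tact bm.rs (u p ⊗ₜ (1 : C)) (tinnR bm.rinn (v p ⊗ₜ (1 : C)) r) := fun r => by
    simp only [← h.tact_linn, ← bm.isSesq_tact_ls.sum_left, tinnL_tmul, star_one, mul_one,
      ← TensorProduct.sum_tmul, huv, ← Algebra.TensorProduct.one_def, tact_ls_one]
  rw [key x, key y]
  simp only [hxy]

/-- A left `A`-linear map `X → X ⊗ C` is given by an element of `B ⊗ C`. -/
lemma IsEquivalence.exists_eq_tact_rs (h : bm.IsEquivalence) (μ : X → X ⊗[ℂ] C)
    (hadd : ∀ x y, μ (x + y) = μ x + μ y)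
    (hμ : ∀ a x, μ (bm.ls a x) = tact bm.ls (a ⊗ₜ (1 : C)) (μ x)) :
    ∃ z : B ⊗[ℂ] C, ∀ x, μ x = tact bm.rs (x ⊗ₜ (1 : C)) z := by
  obtain ⟨I, u, v, huv⟩ := h.exists_sum_rinn
  refine ⟨∑ p ∈ I, tinnR bm.rinn (u p ⊗ₜ (1 : C)) (μ (v p)), fun x => ?_⟩
  have hx : x = ∑ p ∈ I, bm.ls (bm.linn x (u p)) (v p) := by
    simp only [h.1, ← bm.isSesq_rs.sum_right, huv, bm.rs_one]
  have hsum (f : X × X → X) : μ (∑ p ∈ I, f p) = ∑ p ∈ I, μ (f p) :=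
    map_sum (AddMonoidHom.mk' μ hadd) f I
  conv_lhs => rw [hx, hsum]
  simp [hμ, bm.isSesq_tact_rs.sum_right, ← h.tact_linn]

/-- A right `B`-linear map `X → X ⊗ C` is given by an element of `A ⊗ C`. -/
lemma IsEquivalence.exists_eq_tact_ls (h : bm.IsEquivalence) (μ : X → X ⊗[ℂ] C)
    (hadd : ∀ x y, μ (x + y) = μ x + μ y)
    (hμ : ∀ x b, μ (bm.rs x b) = tact bm.rs (μ x) (b ⊗ₜ (1 : C))) :
    ∃ z : A ⊗[ℂ] C, ∀ x, μ x = tact bm.ls z (x ⊗ₜ (1 : C)) := by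
  obtain ⟨I, u, v, huv⟩ := h.exists_sum_linn
  refine ⟨∑ p ∈ I, tinnL bm.linn (μ (u p)) (v p ⊗ₜ (1 : C)), fun x => ?_⟩
  have hx : x = ∑ p ∈ I, bm.rs (u p) (bm.rinn (v p) x) := by
    simp only [← h.1, ← bm.isSesq_ls.sum_left, huv, bm.ls_one]
  have hsum (f : X × X → X) : μ (∑ p ∈ I, f p) = ∑ p ∈ I, μ (f p) :=
    map_sum (AddMonoidHom.mk' μ hadd) f I
  conv_lhs => rw [hx, hsum]
  simp [hμ, bm.isSesq_tact_ls.sum_left, h.tact_linn]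

end Equivalence

end Bimod

end BimodTensor

/-! ### Innerness is invariant under strong Morita equivalence -/

section Inner

variable {A B X K : Type u} [Ring A] [Algebra ℂ A] [StarRing A] [StarModule ℂ A]
  [Ring B] [Algebra ℂ B] [StarRing B] [StarModule ℂ B] [AddCommGroup X] [Module ℂ X]
  [Ring K] [Algebra ℂ K] [FiniteDimensional ℂ K] [StarRing K] [StarModule ℂ K]
  {ρ : A →ₗ[ℂ] A ⊗[ℂ] K} {σ : B →ₗ[ℂ] B ⊗[ℂ] K} {bm : Bimod A B X} {lam : X →ₗ[ℂ] X ⊗[ℂ] K}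

/-- A weak coaction on a bimodule may be pushed forward along a homomorphism of C*-Hopf
algebras. -/
lemma IsWeakCoactionBimod.map {H0 : Type u} [Ring H0] [Algebra ℂ H0] [StarRing H0]
    [StarModule ℂ H0] [FiniteDimensional ℂ H0] {ρ : A →ₗ[ℂ] A ⊗[ℂ] H0} {σ : B →ₗ[ℂ] B ⊗[ℂ] H0}
    {lam : X →ₗ[ℂ] X ⊗[ℂ] H0} {hd : HopfAlgData H0} {dK : HopfAlgData K} {π : H0 →ₐ[ℂ] K}
    (hlam : IsWeakCoactionBimod hd.counit.toLinearMap bm ρ σ lam) (hπ : IsHopfHom hd dK π) :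
    IsWeakCoactionBimod dK.counit.toLinearMap bm
      (TensorProduct.map LinearMap.id π.toLinearMap ∘ₗ ρ)
      (TensorProduct.map LinearMap.id π.toLinearMap ∘ₗ σ)
      (TensorProduct.map LinearMap.id π.toLinearMap ∘ₗ lam) where
  ls_compat a x := by
    simp only [LinearMap.comp_apply, hlam.ls_compat]
    exact map_tmix bm.isSesq_ls isSesq_mul isSesq_mul _ (by simp) _ _
  rs_compat x b := by
    simp only [LinearMap.comp_apply, hlam.rs_compat]
    exact map_tmix bm.isSesq_rs isSesq_mul isSesq_mul _ (by simp) _ _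
  linn_compat x y := by
    simp only [LinearMap.comp_apply, hlam.linn_compat]
    exact map_tmix bm.isSesq_linn isSesq_mul_star isSesq_mul_star _ (by simp [hπ.map_star]) _ _
  rinn_compat x y := by
    simp only [LinearMap.comp_apply, hlam.rinn_compat]
    exact map_tmix bm.isSesq_rinn isSesq_star_mul isSesq_star_mul _ (by simp [hπ.map_star]) _ _
  counital x := by
    have : ∀ t : X ⊗[ℂ] H0, appRight dK.counit.toLinearMap
        (TensorProduct.map LinearMap.id π.toLinearMap t) = appRight hd.counit.toLinearMap t := by
      intro t
      induction t with
      | zero => simp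
      | add s t hs ht => simp [hs, ht]
      | tmul x c => simp [hπ.counit_compat]
    simp only [LinearMap.comp_apply, this, hlam.counital]

variable {ε : K →ₐ[ℂ] ℂ}

lemma IsInnerCoaction.of_left (hbm : bm.IsEquivalence)
    (hε : ∀ k, ε (star k) = starRingEnd ℂ (ε k)) (hσ : σ 1 = 1)
    (hlam : IsWeakCoactionBimod ε.toLinearMap bm ρ σ lam)
    (hρ : IsInnerCoaction ε.toLinearMap ρ) : IsInnerCoaction ε.toLinearMap σ := by
  obtain ⟨w, hw, hw', hwρ, hwε⟩ := hρ
  obtain ⟨z, hz⟩ := hbm.exists_eq_tact_rs (fun x => tact bm.ls (tstarWith star w) (lam x))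
    (fun x y => by simp [bm.isSesq_tact_ls.add_right])
    (fun a x => by
      rw [hlam.ls_compat, hwρ, ← bm.tact_ls_mul, ← bm.tact_ls_mul, ← mul_assoc, ← mul_assoc, hw',
        one_mul])
  have hσz : ∀ b, σ b = tstarWith star z * (b ⊗ₜ (1 : K)) * z := by
    intro b
    have : σ = LinearMap.mulLeftRight ℂ (tstarWith star z, z) ∘ₗ (TensorProduct.mk ℂ B K).flip 1 :=
      hbm.linearMap_ext_rinn fun x y => by
        have : σ (bm.rinn x y) = tinnR bm.rinn (tact bm.ls (tstarWith star w) (lam x))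
            (tact bm.ls (tstarWith star w) (lam y)) := by
          rw [bm.tinnR_ls_left, tstarWith_tstarWith, ← bm.tact_ls_mul, hw, bm.tact_ls_one,
            hlam.rinn_compat]
        rw [this, hz, hz, bm.tinnR_rs, bm.tinnR_rs_left]
        simp
    rw [this]
    simp
  have hzz : tstarWith star z * z = 1 := by
    rw [← hσ, hσz 1, ← Algebra.TensorProduct.one_def, mul_one]
  have hzz' : z * tstarWith star z = 1 := hbm.eq_of_tact_rs fun x => hbm.eq_of_tinnL fun y => by
    have : tinnL bm.linn (tact bm.ls (tstarWith star w) (lam x))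
        (tact bm.ls (tstarWith star w) (lam y)) = bm.linn x y ⊗ₜ 1 := by
      rw [bm.tinnL_ls, bm.tinnL_ls_right, tstarWith_tstarWith, ← hlam.linn_compat, hwρ, mul_assoc,
        mul_assoc, hw', mul_one, ← mul_assoc, hw', one_mul]
    rw [hz, hz, bm.tinnL_rs_right, ← bm.tact_rs_mul] at this
    rw [this, bm.tact_rs_one]
    simp
  refine ⟨tstarWith star z, by simpa, by simpa, by simpa, ?_⟩
  have hzε : appRight ε.toLinearMap z = 1 := by
    have hx : ∀ x, x = bm.rs x (appRight ε.toLinearMap z) := fun x => by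
      have := congrArg (appRight ε.toLinearMap) (hz x)
      simpa [bm.appRight_tact_ls, bm.appRight_tact_rs, hlam.counital, hwε,
        appRight_tstarWith ε.toLinearMap hε, bm.ls_one] using this
    obtain ⟨I, u, v, huv⟩ := hbm.exists_sum_rinn
    calc appRight ε.toLinearMap z
        = ∑ p ∈ I, bm.rinn (u p) (bm.rs (v p) (appRight ε.toLinearMap z)) := by
          simp only [bm.rinn_rs, ← Finset.sum_mul, huv, one_mul]
      _ = 1 := by simp only [← hx, huv]
  rw [appRight_tstarWith ε.toLinearMap hε, hzε, star_one]

lemma IsInnerCoaction.of_right (hbm : bm.IsEquivalence)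
    (hρ : ρ 1 = 1)
    (hlam : IsWeakCoactionBimod ε.toLinearMap bm ρ σ lam)
    (hσ : IsInnerCoaction ε.toLinearMap σ) : IsInnerCoaction ε.toLinearMap ρ := by
  obtain ⟨w, hw, hw', hwσ, hwε⟩ := hσ
  obtain ⟨z, hz⟩ := hbm.exists_eq_tact_ls (fun x => tact bm.rs (lam x) w)
    (fun x y => by simp [bm.isSesq_tact_rs.add_left])
    (fun x b => by
      rw [hlam.rs_compat, hwσ, ← bm.tact_rs_mul, ← bm.tact_rs_mul, mul_assoc, hw', mul_one])
  have hρz : ∀ a, ρ a = z * (a ⊗ₜ (1 : K)) * tstarWith star z := by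
    intro a
    have : ρ = LinearMap.mulLeftRight ℂ (z, tstarWith star z) ∘ₗ (TensorProduct.mk ℂ A K).flip 1 :=
      hbm.linearMap_ext_linn fun x y => by
        have : ρ (bm.linn x y) = tinnL bm.linn (tact bm.rs (lam x) w) (tact bm.rs (lam y) w) := by
          rw [bm.tinnL_rs_right, ← bm.tact_rs_mul, hw, bm.tact_rs_one, hlam.linn_compat]
        rw [this, hz, hz, bm.tinnL_ls, bm.tinnL_ls_right]
        simp [mul_assoc]
    rw [this]
    simp
  have hzz : z * tstarWith star z = 1 := by
    rw [← hρ, hρz 1, ← Algebra.TensorProduct.one_def, mul_one]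
  have hzz' : tstarWith star z * z = 1 := hbm.eq_of_tact_ls fun x => hbm.eq_of_tinnR fun y => by
    have : tinnR bm.rinn (tact bm.rs (lam y) w) (tact bm.rs (lam x) w) = bm.rinn y x ⊗ₜ 1 := by
      rw [bm.tinnR_rs, bm.tinnR_rs_left, ← hlam.rinn_compat, hwσ, mul_assoc, mul_assoc, hw',
        mul_one, ← mul_assoc, hw', one_mul]
    rw [hz, hz, bm.tinnR_ls_left, ← bm.tact_ls_mul] at this
    rw [this, bm.tact_ls_one]
    simp
  refine ⟨z, hzz, hzz', hρz, ?_⟩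
  have hx : ∀ x, x = bm.ls (appRight ε.toLinearMap z) x := fun x => by
    have := congrArg (appRight ε.toLinearMap) (hz x)
    simpa [bm.appRight_tact_ls, bm.appRight_tact_rs, hlam.counital, hwε, bm.rs_one] using this
  obtain ⟨I, u, v, huv⟩ := hbm.exists_sum_linn
  calc appRight ε.toLinearMap z
      = ∑ p ∈ I, bm.linn (bm.ls (appRight ε.toLinearMap z) (u p)) (v p) := by
        simp only [bm.linn_ls, ← Finset.mul_sum, huv, mul_one]
    _ = 1 := by simp only [← hx, huv]

end Inner

/-- Suppose `H0` is not trivial.  Let `ρ` and `σ` be coactions of `H0` on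
unital C*-algebras `A` and `B` respectively.  If `ρ` is strongly Morita equivalent to `σ`,
then `ρ` is outer if and only if `σ` is outer. -/
theorem outer_of_strongMorita
    {H0 : Type u} [CStarAlgebra H0] [StarModule ℂ H0] [FiniteDimensional ℂ H0]
    {A B : Type u} [CStarAlgebra A] [StarModule ℂ A] [CStarAlgebra B] [StarModule ℂ B]
    (hd : HopfAlgData H0) (hnontriv : 1 < Module.finrank ℂ H0)
    (ρ : A →ₗ[ℂ] A ⊗[ℂ] H0) (σ : B →ₗ[ℂ] B ⊗[ℂ] H0)
    (hρ : IsCoaction hd.comul.toLinearMap hd.counit.toLinearMap ρ)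
    (hσ : IsCoaction hd.comul.toLinearMap hd.counit.toLinearMap σ)
    (hSME : CoactSME hd.comul.toLinearMap hd.counit.toLinearMap ρ σ) :
    IsOuterCoaction hd ρ ↔ IsOuterCoaction hd σ := by
  obtain ⟨X, _, _, bm, hbm, lam, hlam⟩ := hSME
  constructor
  · intro h K _ _ _ dK π hπ hsurj hK hin
    refine h K _ _ _ dK π hπ hsurj hK (hin.of_right hbm ?_ (hlam.map hπ))
    simp [hρ.map_one, Algebra.TensorProduct.one_def]
  · intro h K _ _ _ dK π hπ hsurj hK hin
    refine h K _ _ _ dK π hπ hsurj hK (hin.of_left hbm dK.counit_star ?_ (hlam.map hπ))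
    simp [hσ.map_one, Algebra.TensorProduct.one_def]

end SMEPaper
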